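/- arXiv:2303.13925 — 2 statements merged into one kernel-verified Lean document; each statement's English description precedes it below -/
import Mathlib

section
/- Fermionic commutator formula (Theorem 3.2, even case, discrete-mode form): for all n_A, m_A, n_B, m_B ∈ ℕ with (n_A + m_A)·(n_B + m_B) even, and all finitely supported kernels f_A : (Fin n_A → ι) × (Fin m_A → ι) → ℂ and f_B : (Fin n_B → ι) × (Fin m_B → ι) → ℂ, one has Op(f_A) * Op(f_B) − Op(f_B) * Op(f_A) = Op(f_A) Γ₋ Op(f_B) − Op(f_B) Γ₋ Op(f_A), where Op(f_B) Γ₋ Op(f_A) is the fermionic attached product with the roles of A and B interchanged (sum over 𝒞(m_B, n_A) with signs sgn(π,π',m_B,n_A)). -/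
open scoped Classical

noncomputable section

/-- The unique permutation `σ` of `Fin n` taking the contraction `π` into maximally
crossed form: `σ (π c)` has value `n − 1 − c` (i.e. `σ` sends the `c`-th contracted
connector to the `c`-th top-most position), and `σ` is strictly increasing on the
complement of the range of `π`.  (Defined by choice; for injective `π` such a
permutation exists and is unique.) -/
def maxCrossPerm {n C : ℕ} (π : Fin C → Fin n) : Equiv.Perm (Fin n) :=
  if h : ∃ σ : Equiv.Perm (Fin n),
      (∀ c : Fin C, ((σ (π c) : Fin n) : ℕ) = n - 1 - (c : ℕ)) ∧
      ∀ u₁ u₂ : Fin n, u₁ ∉ Set.range π → u₂ ∉ Set.range π → u₁ < u₂ → σ u₁ < σ u₂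
  then h.choose else 1

/-- The sign `sgn(π, π', m, n) = (−1)^{(m−C)(n−C)} · sign σ · sign σ'` of a contraction
configuration. -/
def configSign {m n C : ℕ} (π : Fin C → Fin n) (π' : Fin C → Fin m) : ℤ :=
  (-1) ^ ((m - C) * (n - C)) *
    ((Equiv.Perm.sign (maxCrossPerm π) : ℤˣ) : ℤ) *
    ((Equiv.Perm.sign (maxCrossPerm π') : ℤˣ) : ℤ)

variable {ι : Type*} [DecidableEq ι] {R : Type*} [Ring R] [Algebra ℂ R]

/-- `FOp a adag f` is the normal ordered operator
`Σ_{(X,Y)} f(X,Y) · a⁺_{X n} ⋯ a⁺_{X 1} · a_{Y 1} ⋯ a_{Y m}` associated with a finitely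
supported kernel `f`. -/
def FOp (a adag : ι → R) {n m : ℕ} (f : ((Fin n → ι) × (Fin m → ι)) →₀ ℂ) : R :=
  f.sum fun XY c =>
    c • ((List.ofFn fun i => adag (XY.1 i)).reverse.prod *
         (List.ofFn fun j => a (XY.2 j)).prod)

/-- The fermionic attached product `Op(f_A) Γ₋ Op(f_B)`: a signed sum over all contraction
configurations `(π, π')`, where `π` (strictly decreasing) picks left connectors of `B`
and `π'` (injective) picks right connectors of `A`. Uncontracted connectors keep their
order (contracted ones are replaced by the unit `1` inside the ordered products). -/
def FAttachF (a adag : ι → R) {nA mA nB mB : ℕ}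
    (fA : ((Fin nA → ι) × (Fin mA → ι)) →₀ ℂ)
    (fB : ((Fin nB → ι) × (Fin mB → ι)) →₀ ℂ) : R :=
  ∑ C ∈ Finset.Icc 1 (min mA nB),
    ∑ π ∈ Finset.univ.filter (fun π : Fin C → Fin nB => StrictAnti π),
      ∑ π' ∈ Finset.univ.filter (fun π' : Fin C → Fin mA => Function.Injective π'),
        fA.sum fun XYA cA => fB.sum fun XYB cB =>
          ((configSign π π' : ℂ) * cA * cB *
              ∏ c : Fin C, if XYB.1 (π c) = XYA.2 (π' c) then (1 : ℂ) else 0) •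
            ((List.ofFn fun i => adag (XYA.1 i)).reverse.prod *
             (List.ofFn fun i : Fin nB =>
                if ∃ c, π c = i then (1 : R) else adag (XYB.1 i)).reverse.prod *
             (List.ofFn fun j : Fin mA =>
                if ∃ c, π' c = j then (1 : R) else a (XYA.2 j)).prod *
             (List.ofFn fun j => a (XYB.2 j)).prod)

/-- The defining property of `maxCrossPerm π`. -/
def IsMaxCross {n C : ℕ} (π : Fin C → Fin n) (σ : Equiv.Perm (Fin n)) : Prop :=
  (∀ c : Fin C, ((σ (π c) : Fin n) : ℕ) = n - 1 - (c : ℕ)) ∧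
    ∀ u₁ u₂ : Fin n, u₁ ∉ Set.range π → u₂ ∉ Set.range π → u₁ < u₂ → σ u₁ < σ u₂

theorem IsMaxCross.unique {n C : ℕ} {π : Fin C → Fin n} {σ τ : Equiv.Perm (Fin n)}
    (hσ : IsMaxCross π σ) (hτ : IsMaxCross π τ) : σ = τ := by
  have hπ : ∀ c, σ (π c) = τ (π c) := fun c => Fin.ext ((hσ.1 c).trans (hτ.1 c).symm)
  have hrange : ∀ ρ : Equiv.Perm (Fin n),
      Set.range (fun u : {u // u ∉ Set.range π} => ρ u) = (Set.range fun c => ρ (π c))ᶜ := by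
    intro ρ
    ext x
    simp only [Set.mem_range, Subtype.exists, Set.mem_compl_iff, not_exists]
    constructor
    · rintro ⟨u, hu, rfl⟩ c hc
      exact hu c (ρ.injective hc)
    · intro h
      exact ⟨ρ.symm x, fun c hc => h c (by simp [hc]), by simp⟩
  have hfun : (fun u : {u // u ∉ Set.range π} => σ u) = fun u : {u // u ∉ Set.range π} => τ u := by
    have hmono : ∀ ρ, IsMaxCross π ρ →
        StrictMono (fun u : {u // u ∉ Set.range π} => ρ u) :=
      fun ρ hρ u v h => hρ.2 _ _ u.2 v.2 h
    rw [← StrictMono.range_inj (hmono σ hσ) (hmono τ hτ), hrange, hrange]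
    simp only [hπ]
  ext u : 1
  by_cases hu : u ∈ Set.range π
  · obtain ⟨c, rfl⟩ := hu
    exact hπ c
  · exact congrFun hfun ⟨u, hu⟩

theorem IsMaxCross.maxCrossPerm_eq {n C : ℕ} {π : Fin C → Fin n} {σ : Equiv.Perm (Fin n)}
    (hσ : IsMaxCross π σ) : maxCrossPerm π = σ := by
  have h : ∃ σ, IsMaxCross π σ := ⟨σ, hσ⟩
  have hdef : maxCrossPerm π = h.choose := dif_pos h
  rw [hdef]
  exact h.choose_spec.unique hσ

/-- The permutation sending `j` to `i` and acting as `σ` on the remaining points. -/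
def insertPerm {n : ℕ} (i j : Fin (n + 1)) (σ : Equiv.Perm (Fin n)) :
    Equiv.Perm (Fin (n + 1)) :=
  (Fin.cycleRange i)⁻¹ * Equiv.Perm.decomposeFin.symm (0, σ) * Fin.cycleRange j

theorem insertPerm_self {n : ℕ} (i j : Fin (n + 1)) (σ : Equiv.Perm (Fin n)) :
    insertPerm i j σ j = i := by
  simp [insertPerm, Equiv.Perm.inv_def]

theorem insertPerm_succAbove {n : ℕ} (i j : Fin (n + 1)) (σ : Equiv.Perm (Fin n)) (k : Fin n) :
    insertPerm i j σ (j.succAbove k) = i.succAbove (σ k) := by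
  simp [insertPerm, Equiv.Perm.inv_def]

theorem sign_insertPerm {n : ℕ} (i j : Fin (n + 1)) (σ : Equiv.Perm (Fin n)) :
    Equiv.Perm.sign (insertPerm i j σ) = (-1) ^ (i + j : ℕ) * Equiv.Perm.sign σ := by
  simp [insertPerm, pow_add, mul_right_comm]

theorem IsMaxCross.cons {n C : ℕ} {π : Fin C → Fin n} {σ : Equiv.Perm (Fin n)}
    (hσ : IsMaxCross π σ) (j : Fin (n + 1)) :
    IsMaxCross (Fin.cons j (fun c => j.succAbove (π c)) : Fin (C + 1) → Fin (n + 1))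
      (insertPerm (Fin.last n) j σ) := by
  have hmem : ∀ u, u ∉ Set.range (Fin.cons j (fun c => j.succAbove (π c)) :
      Fin (C + 1) → Fin (n + 1)) → ∃ v, v ∉ Set.range π ∧ u = j.succAbove v := by
    intro u hu
    obtain ⟨v, rfl⟩ := Fin.exists_succAbove_eq (x := u) (y := j)
      (fun h => hu ⟨0, by simp [h]⟩)
    refine ⟨v, ?_, rfl⟩
    rintro ⟨c, rfl⟩
    exact hu ⟨c.succ, by simp⟩
  constructor
  · intro c
    refine Fin.cases ?_ (fun c => ?_) c
    · simp [insertPerm_self]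
    · have := hσ.1 c
      simp only [Fin.cons_succ, insertPerm_succAbove, Fin.succAbove_last, Fin.val_castSucc,
        Fin.val_succ, this]
      omega
  · intro u₁ u₂ h₁ h₂ h
    obtain ⟨v₁, hv₁, rfl⟩ := hmem u₁ h₁
    obtain ⟨v₂, hv₂, rfl⟩ := hmem u₂ h₂
    simp only [insertPerm_succAbove, Fin.succAbove_lt_succAbove_iff] at h ⊢
    exact hσ.2 _ _ hv₁ hv₂ h

theorem IsMaxCross.castSucc {n C : ℕ} {π : Fin C → Fin n} {σ : Equiv.Perm (Fin n)}
    (hσ : IsMaxCross π σ) (hC : C ≤ n) :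
    IsMaxCross (fun c => (π c).castSucc)
      (insertPerm ⟨n - C, by omega⟩ (Fin.last n) σ) := by
  have happ : ∀ k : Fin n, insertPerm ⟨n - C, by omega⟩ (Fin.last n) σ k.castSucc =
      Fin.succAbove ⟨n - C, by omega⟩ (σ k) := by
    intro k
    rw [← insertPerm_succAbove _ (Fin.last n), Fin.succAbove_last]
  have hlt : ∀ k, k ∉ Set.range π → (σ k : ℕ) < n - C := by
    intro k hk
    by_contra! hle
    have hkn := (σ k).2
    have hc : n - 1 - (σ k : ℕ) < C := by omega
    refine hk ⟨⟨_, hc⟩, σ.injective (Fin.ext ?_)⟩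
    rw [hσ.1]
    simp only
    omega
  constructor
  · intro c
    have h1 := hσ.1 c
    have h2 := (σ (π c)).2
    have h3 := c.2
    have h4 : n - C ≤ (σ (π c) : ℕ) := by omega
    simp only [happ]
    rw [Fin.succAbove_of_le_castSucc _ _ (by rw [Fin.le_def]; exact h4), Fin.val_succ, h1]
    omega
  · intro u₁ u₂ h₁ h₂ h
    have hmem : ∀ v : Fin n, v.castSucc ∉ Set.range (fun c => (π c).castSucc) →
        v ∉ Set.range π := by
      rintro v hv ⟨c, rfl⟩
      exact hv ⟨c, rfl⟩
    induction u₁ using Fin.lastCases with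
    | last => exact absurd h (not_lt.2 (Fin.le_last _))
    | cast v₁ =>
      induction u₂ using Fin.lastCases with
      | last =>
        have := hlt _ (hmem _ h₁)
        rw [happ, insertPerm_self, Fin.succAbove_of_castSucc_lt _ _ (by rw [Fin.lt_def]; simpa)]
        rw [Fin.lt_def]
        simpa
      | cast v₂ =>
        rw [happ, happ, Fin.succAbove_lt_succAbove_iff]
        exact hσ.2 _ _ (hmem _ h₁) (hmem _ h₂) (by simpa using h)

theorem exists_eq_cons_succAbove {n C : ℕ} {π : Fin (C + 1) → Fin (n + 1)}
    (hπ : Function.Injective π) :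
    ∃ π₀ : Fin C → Fin n, Function.Injective π₀ ∧
      π = Fin.cons (π 0) (fun c => (π 0).succAbove (π₀ c)) := by
  have h : ∀ c : Fin C, ∃ k, (π 0).succAbove k = π c.succ := fun c =>
    Fin.exists_succAbove_eq (fun h => Fin.succ_ne_zero c (hπ h))
  choose π₀ h using h
  refine ⟨π₀, fun c d hcd => ?_, ?_⟩
  · have := h c
    rw [hcd, h d] at this
    exact (Fin.succ_injective _ (hπ this)).symm
  · funext c
    refine Fin.cases ?_ (fun c => ?_) c
    · simp
    · simp [h]

theorem exists_isMaxCross {n C : ℕ} {π : Fin C → Fin n} (hπ : Function.Injective π) :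
    ∃ σ, IsMaxCross π σ := by
  induction C generalizing n with
  | zero => exact ⟨1, fun c => c.elim0, fun _ _ _ _ h => h⟩
  | succ C ih =>
    cases n with
    | zero => exact (π 0).elim0
    | succ n =>
      obtain ⟨π₀, h₀, h⟩ := exists_eq_cons_succAbove hπ
      obtain ⟨σ, hσ⟩ := ih h₀
      rw [h]
      exact ⟨_, hσ.cons _⟩

theorem sign_maxCrossPerm_cons {n C : ℕ} {π : Fin C → Fin n} (hπ : Function.Injective π)
    (j : Fin (n + 1)) :
    Equiv.Perm.sign (maxCrossPerm
      (Fin.cons j (fun c => j.succAbove (π c)) : Fin (C + 1) → Fin (n + 1))) =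
      (-1) ^ (n + j : ℕ) * Equiv.Perm.sign (maxCrossPerm π) := by
  obtain ⟨σ, hσ⟩ := exists_isMaxCross hπ
  rw [(hσ.cons j).maxCrossPerm_eq, hσ.maxCrossPerm_eq, sign_insertPerm, Fin.val_last]

theorem sign_maxCrossPerm_castSucc {n C : ℕ} {π : Fin C → Fin n} (hπ : Function.Injective π) :
    Equiv.Perm.sign (maxCrossPerm fun c => (π c).castSucc) =
      (-1) ^ C * Equiv.Perm.sign (maxCrossPerm π) := by
  obtain ⟨σ, hσ⟩ := exists_isMaxCross hπ
  have hC : C ≤ n := by simpa using Fintype.card_le_of_injective π hπ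
  rw [(hσ.castSucc hC).maxCrossPerm_eq, hσ.maxCrossPerm_eq, sign_insertPerm, Fin.val_last]
  congr 1
  apply neg_one_pow_congr
  simp only [Nat.even_add, Nat.even_sub hC]
  tauto

theorem configSign_cons {m n C : ℕ} {π : Fin C → Fin n} {π' : Fin C → Fin m}
    (hπ : Function.Injective π) (hπ' : Function.Injective π') (j : Fin (m + 1)) :
    configSign (Fin.cons (Fin.last n) (fun c => (π c).castSucc) : Fin (C + 1) → Fin (n + 1))
      (Fin.cons j (fun c => j.succAbove (π' c)) : Fin (C + 1) → Fin (m + 1)) =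
      (-1) ^ (m + j : ℕ) * configSign π π' := by
  have h := sign_maxCrossPerm_cons hπ (Fin.last n)
  simp only [Fin.succAbove_last, Fin.val_last] at h
  rw [configSign, configSign, h, sign_maxCrossPerm_cons hπ' j, (Even.add_self n).neg_one_pow]
  simp only [Nat.add_sub_add_right]
  push_cast
  ring

theorem configSign_castSucc {m n C : ℕ} {π : Fin C → Fin n} {π' : Fin C → Fin m}
    (hπ : Function.Injective π) (hπ' : Function.Injective π') :
    configSign (fun c => (π c).castSucc) π' = (-1) ^ m * configSign π π' := by
  have hC : C ≤ n := by simpa using Fintype.card_le_of_injective π hπ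
  have hC' : C ≤ m := by simpa using Fintype.card_le_of_injective π' hπ'
  obtain ⟨k, rfl⟩ := Nat.exists_eq_add_of_le hC'
  rw [configSign, configSign, sign_maxCrossPerm_castSucc hπ, Nat.sub_add_comm hC]
  push_cast
  rw [Nat.add_sub_cancel_left]
  ring

theorem List.prod_ofFn_succAbove {M : Type*} [Monoid M] {n : ℕ} (g : Fin (n + 1) → M)
    (j : Fin (n + 1)) (hj : g j = 1) :
    (List.ofFn g).prod = (List.ofFn fun k => g (j.succAbove k)).prod := by
  induction n with
  | zero =>
    obtain rfl : j = 0 := Fin.fin_one_eq_zero j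
    simp [hj]
  | succ n ih =>
    induction j using Fin.cases with
    | zero => simp [hj]
    | succ j =>
      rw [List.ofFn_succ, List.ofFn_succ (f := fun k => g (j.succ.succAbove k)), List.prod_cons,
        List.prod_cons, ih (fun k => g k.succ) j hj]
      simp

/-- The ordered product of the annihilation operators that `π'` leaves uncontracted. -/
def remAnn (a : ι → R) {m C : ℕ} (π' : Fin C → Fin m) (Y : Fin m → ι) : R :=
  (List.ofFn fun j : Fin m => if ∃ c, π' c = j then (1 : R) else a (Y j)).prod

/-- The reversely ordered product of the creation operators that `π` leaves uncontracted. -/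
def remCre (adag : ι → R) {n C : ℕ} (π : Fin C → Fin n) (X : Fin n → ι) : R :=
  (List.ofFn fun i : Fin n => if ∃ c, π c = i then (1 : R) else adag (X i)).reverse.prod

/-- The product of the Kronecker deltas attached to the contracted pairs. -/
def contractionWeight {n m C : ℕ} (π : Fin C → Fin n) (π' : Fin C → Fin m)
    (X : Fin n → ι) (Y : Fin m → ι) : ℂ :=
  ∏ c : Fin C, if X (π c) = Y (π' c) then (1 : ℂ) else 0

/-- The sum over all contractions of exactly `C` pairs in
`a_{Y 1} ⋯ a_{Y m} · a⁺_{X n} ⋯ a⁺_{X 1}`. -/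
def wickSum (a adag : ι → R) (C : ℕ) {n m : ℕ} (X : Fin n → ι) (Y : Fin m → ι) : R :=
  ∑ π ∈ Finset.univ.filter (fun π : Fin C → Fin n => StrictAnti π),
    ∑ π' ∈ Finset.univ.filter (fun π' : Fin C → Fin m => Function.Injective π'),
      ((configSign π π' : ℂ) * contractionWeight π π' X Y) •
        (remCre adag π X * remAnn a π' Y)

theorem remAnn_cons {κ S : Type*} [Ring S] (a : κ → S) {m C : ℕ} (π' : Fin C → Fin m)
    (j : Fin (m + 1)) (Y : Fin (m + 1) → κ) :
    remAnn a (Fin.cons j (fun c => j.succAbove (π' c)) : Fin (C + 1) → Fin (m + 1)) Y =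
      remAnn a π' fun k => Y (j.succAbove k) := by
  rw [remAnn, List.prod_ofFn_succAbove (fun _ => ite _ _ _) j (if_pos ⟨0, by simp⟩), remAnn]
  simp [Fin.exists_fin_succ, Fin.ne_succAbove]

theorem remCre_castSucc {κ S : Type*} [Ring S] (adag : κ → S) {n C : ℕ} (π : Fin C → Fin n)
    (X : Fin (n + 1) → κ) :
    remCre adag (fun c => (π c).castSucc) X =
      adag (X (Fin.last n)) * remCre adag π fun k => X k.castSucc := by
  rw [remCre, List.ofFn_succ', remCre]
  simp [Fin.castSucc_ne_last]

theorem remCre_cons {κ S : Type*} [Ring S] (adag : κ → S) {n C : ℕ} (π : Fin C → Fin n)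
    (X : Fin (n + 1) → κ) :
    remCre adag
      (Fin.cons (Fin.last n) (fun c => (π c).castSucc) : Fin (C + 1) → Fin (n + 1)) X =
      remCre adag π fun k => X k.castSucc := by
  rw [remCre, List.ofFn_succ', remCre]
  simp [Fin.exists_fin_succ, Fin.castSucc_ne_last, (Fin.castSucc_ne_last _).symm]

theorem wickSum_zero_right {n m C : ℕ} (a adag : ι → R) (X : Fin n → ι) (Y : Fin m → ι)
    (h : m < C) : wickSum a adag C X Y = 0 := by
  refine Finset.sum_eq_zero fun π _ => Finset.sum_eq_zero fun π' hπ' => ?_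
  have := Fintype.card_le_of_injective π' (Finset.mem_filter.1 hπ').2
  simp at this
  omega

theorem wickSum_zero_left {n m C : ℕ} (a adag : ι → R) (X : Fin n → ι) (Y : Fin m → ι)
    (h : n < C) : wickSum a adag C X Y = 0 := by
  refine Finset.sum_eq_zero fun π hπ => ?_
  have := Fintype.card_le_of_injective π (Finset.mem_filter.1 hπ).2.injective
  simp at this
  omega

theorem wickSum_zero (a adag : ι → R) {n m : ℕ} (X : Fin n → ι) (Y : Fin m → ι) :
    wickSum a adag 0 X Y = (-1 : ℂ) ^ (m * n) •
      ((List.ofFn fun i => adag (X i)).reverse.prod * (List.ofFn fun j => a (Y j)).prod) := by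
  have hmc : ∀ (k : ℕ) (π : Fin 0 → Fin k), maxCrossPerm π = 1 := fun k π =>
    IsMaxCross.maxCrossPerm_eq ⟨fun c => c.elim0, fun _ _ _ _ h => h⟩
  have h1 : ∀ k, (Finset.univ.filter fun π : Fin 0 → Fin k => StrictAnti π) = Finset.univ :=
    fun k => Finset.filter_true_of_mem fun π _ => Subsingleton.strictAnti π
  have h2 : ∀ k, (Finset.univ.filter fun π : Fin 0 → Fin k => Function.Injective π) =
      Finset.univ :=
    fun k => Finset.filter_true_of_mem fun π _ => Function.injective_of_subsingleton π
  rw [wickSum, h1, h2]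
  simp [configSign, hmc, contractionWeight, remCre, remAnn]

theorem sum_strictAnti_castSucc {n C : ℕ} {M : Type*} [AddCommMonoid M]
    (F : (Fin (C + 1) → Fin (n + 1)) → M) :
    ∑ π ∈ Finset.univ.filter (fun π : Fin (C + 1) → Fin (n + 1) => StrictAnti π), F π =
      ∑ π ∈ Finset.univ.filter (fun π : Fin C → Fin n => StrictAnti π),
        F (Fin.cons (Fin.last n) fun c => (π c).castSucc) +
      ∑ π ∈ Finset.univ.filter (fun π : Fin (C + 1) → Fin n => StrictAnti π),
        F fun c => (π c).castSucc := by
  have hcast : ∀ {k : ℕ} (π : Fin k → Fin (n + 1)), (∀ c, π c ≠ Fin.last n) →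
      ∃ π₀ : Fin k → Fin n, (fun c => (π₀ c).castSucc) = π := by
    intro k π h
    exact ⟨fun c => (π c).castPred (h c), by simp⟩
  rw [← Finset.sum_filter_add_sum_filter_not _ (fun π => π 0 = Fin.last n)]
  congr 1
  · symm
    refine Finset.sum_nbij (fun π => Fin.cons (Fin.last n) fun c => (π c).castSucc)
      ?_ ?_ ?_ (fun _ _ => rfl)
    · intro π hπ
      have hπ := (Finset.mem_filter.1 hπ).2
      simp only [Finset.mem_filter, Finset.mem_univ, true_and, Fin.cons_zero, and_true]
      intro c d hcd
      induction d using Fin.cases with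
      | zero => exact absurd hcd (by simp)
      | succ d =>
        induction c using Fin.cases with
        | zero => simp
        | succ c => simpa using hπ (by simpa using hcd)
    · intro π _ ρ _ h
      funext c
      simpa using congrFun h c.succ
    · intro π hπ
      simp only [Finset.coe_filter, Finset.mem_filter, Finset.mem_univ, true_and,
        Set.mem_ofPred_eq] at hπ
      obtain ⟨π₀, h₀⟩ := hcast (fun c : Fin C => π c.succ)
        (fun c h => Fin.succ_ne_zero c (hπ.1.injective (h.trans hπ.2.symm)))
      refine ⟨π₀, ?_, ?_⟩
      · simp only [Finset.coe_filter, Finset.mem_univ, true_and, Set.mem_ofPred_eq]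
        intro c d hcd
        have := hπ.1 (Fin.succ_lt_succ_iff.2 hcd)
        rw [← congrFun h₀ c, ← congrFun h₀ d] at this
        simpa using this
      · funext c
        induction c using Fin.cases with
        | zero => simp [hπ.2]
        | succ c => simpa using congrFun h₀ c
  · symm
    refine Finset.sum_nbij (fun π c => (π c).castSucc) ?_ ?_ ?_ (fun _ _ => rfl)
    · intro π hπ
      have hπ := (Finset.mem_filter.1 hπ).2
      simp only [Finset.mem_filter, Finset.mem_univ, true_and]
      exact ⟨fun c d hcd => by simpa using hπ hcd, Fin.castSucc_ne_last _⟩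
    · intro π _ ρ _ h
      funext c
      simpa using congrFun h c
    · intro π hπ
      simp only [Finset.coe_filter, Finset.mem_filter, Finset.mem_univ, true_and,
        Set.mem_ofPred_eq] at hπ
      obtain ⟨π₀, rfl⟩ := hcast π fun c h => hπ.2
        (le_antisymm (Fin.le_last _) (h ▸ hπ.1.antitone (Fin.zero_le c)))
      refine ⟨π₀, ?_, rfl⟩
      simp only [Finset.coe_filter, Finset.mem_univ, true_and, Set.mem_ofPred_eq]
      exact fun c d hcd => by simpa using hπ.1 hcd

theorem sum_injective_succAbove {m C : ℕ} {M : Type*} [AddCommMonoid M]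
    (F : (Fin (C + 1) → Fin (m + 1)) → M) :
    ∑ π ∈ Finset.univ.filter (fun π : Fin (C + 1) → Fin (m + 1) => Function.Injective π), F π =
      ∑ j : Fin (m + 1),
        ∑ π ∈ Finset.univ.filter (fun π : Fin C → Fin m => Function.Injective π),
          F (Fin.cons j fun c => j.succAbove (π c)) := by
  rw [← Finset.sum_product']
  symm
  refine Finset.sum_nbij (fun p => Fin.cons p.1 fun c => p.1.succAbove (p.2 c))
    ?_ ?_ ?_ (fun _ _ => rfl)
  · rintro ⟨j, π⟩ hπ
    simp only [Finset.mem_product, Finset.mem_filter, Finset.mem_univ, true_and] at hπ ⊢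
    rw [Fin.cons_injective_iff]
    refine ⟨?_, (Fin.succAbove_right_injective).comp hπ⟩
    rintro ⟨c, hc⟩
    exact Fin.succAbove_ne _ _ hc
  · rintro ⟨j, π⟩ _ ⟨k, ρ⟩ _ h
    obtain rfl : j = k := by simpa using congrFun h 0
    congr 1
    funext c
    simpa using congrFun h c.succ
  · intro π hπ
    simp only [Finset.coe_filter, Finset.mem_univ, true_and, Set.mem_ofPred_eq] at hπ
    obtain ⟨π₀, h₀, h⟩ := exists_eq_cons_succAbove hπ
    exact ⟨(π 0, π₀), by simp [h₀], h.symm⟩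

/-- Contractions that leave the leftmost creation operator uncontracted. -/
theorem sum_castSucc_eq (a adag : ι → R) (C : ℕ) {n m : ℕ} (X : Fin (n + 1) → ι)
    (Y : Fin m → ι) :
    ∑ π ∈ Finset.univ.filter (fun π : Fin C → Fin n => StrictAnti π),
      ∑ π' ∈ Finset.univ.filter (fun π' : Fin C → Fin m => Function.Injective π'),
        ((configSign (fun c => (π c).castSucc) π' : ℂ) *
            contractionWeight (fun c => (π c).castSucc) π' X Y) •
          (remCre adag (fun c => (π c).castSucc) X * remAnn a π' Y) =
      (-1 : ℂ) ^ m • (adag (X (Fin.last n)) * wickSum a adag C (fun k => X k.castSucc) Y) := by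
  simp only [wickSum, Finset.mul_sum, Finset.smul_sum]
  refine Finset.sum_congr rfl fun π hπ => Finset.sum_congr rfl fun π' hπ' => ?_
  rw [configSign_castSucc (Finset.mem_filter.1 hπ).2.injective (Finset.mem_filter.1 hπ').2,
    remCre_castSucc, mul_smul_comm, smul_smul, mul_assoc (adag _)]
  congr 1
  simp only [contractionWeight]
  push_cast
  ring

theorem wickSum_succ (a adag : ι → R) (C : ℕ) {n m : ℕ} (X : Fin (n + 1) → ι)
    (Y : Fin (m + 1) → ι) :
    wickSum a adag (C + 1) X Y =
      ∑ j : Fin (m + 1), ((-1 : ℂ) ^ (m + j : ℕ) * if X (Fin.last n) = Y j then 1 else 0) •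
        wickSum a adag C (fun k => X k.castSucc) (fun k => Y (j.succAbove k)) +
      (-1 : ℂ) ^ (m + 1) •
        (adag (X (Fin.last n)) * wickSum a adag (C + 1) (fun k => X k.castSucc) Y) := by
  rw [wickSum, sum_strictAnti_castSucc, sum_castSucc_eq]
  congr 1
  simp only [sum_injective_succAbove, wickSum, Finset.smul_sum]
  rw [Finset.sum_comm]
  refine Finset.sum_congr rfl fun j _ => Finset.sum_congr rfl fun π hπ =>
    Finset.sum_congr rfl fun π' hπ' => ?_
  rw [configSign_cons (Finset.mem_filter.1 hπ).2.injective (Finset.mem_filter.1 hπ').2,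
    remCre_cons, remAnn_cons, smul_smul]
  congr 1
  simp only [contractionWeight, Fin.prod_univ_succ, Fin.cons_zero, Fin.cons_succ]
  push_cast
  ring

theorem wickSum_zero_succ (a adag : ι → R) {n m : ℕ} (X : Fin (n + 1) → ι) (Y : Fin m → ι) :
    wickSum a adag 0 X Y = (-1 : ℂ) ^ m •
      (adag (X (Fin.last n)) * wickSum a adag 0 (fun k => X k.castSucc) Y) := by
  rw [wickSum_zero, wickSum_zero, List.ofFn_succ', mul_smul_comm, smul_smul, ← pow_add]
  simp [mul_add, add_comm, mul_assoc]

theorem prod_ofFn_mul_adag (a adag : ι → R)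
    (hcar1 : ∀ i j, a i * adag j + adag j * a i = if i = j then 1 else 0)
    {m : ℕ} (Y : Fin m → ι) (x : ι) :
    (List.ofFn fun j => a (Y j)).prod * adag x =
      (-1 : ℂ) ^ m • (adag x * (List.ofFn fun j => a (Y j)).prod) +
      ∑ j : Fin m, ((-1 : ℂ) ^ (m + j + 1 : ℕ) * if x = Y j then 1 else 0) •
        (List.ofFn fun k => if k = j then 1 else a (Y k)).prod := by
  induction m with
  | zero => simp
  | succ m ih =>
    have h : a (Y 0) * adag x =
        (if x = Y 0 then (1 : ℂ) else 0) • (1 : R) - adag x * a (Y 0) := by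
      rw [eq_sub_iff_add_eq, hcar1]
      by_cases hx : x = Y 0
      · simp [hx]
      · simp [hx, Ne.symm hx]
    rw [List.ofFn_succ, List.prod_cons, mul_assoc, ih, mul_add, mul_smul_comm, ← mul_assoc, h,
      Fin.sum_univ_succ, sub_mul, smul_mul_assoc, one_mul, Finset.mul_sum]
    simp only [mul_smul_comm, List.ofFn_succ, List.prod_cons, Fin.succ_inj, if_true, one_mul,
      Fin.succ_ne_zero, (Fin.succ_ne_zero _).symm, if_false, Fin.val_zero, Fin.val_succ]
    have hs : ∀ j : Fin m, (-1 : ℂ) ^ (m + 1 + (j + 1) + 1 : ℕ) = (-1) ^ (m + j + 1 : ℕ) := by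
      intro j
      rw [show (m + 1 + (j + 1) + 1 : ℕ) = m + j + 1 + 2 by ring, pow_add]
      simp
    simp only [hs, smul_sub, smul_smul, pow_succ, add_zero, mul_assoc]
    module

/-- **Wick's theorem**: normal ordering of `a_{Y 1} ⋯ a_{Y m} · a⁺_{X n} ⋯ a⁺_{X 1}`. -/
theorem wick_theorem (a adag : ι → R)
    (hcar1 : ∀ i j, a i * adag j + adag j * a i = if i = j then 1 else 0)
    {n m : ℕ} (X : Fin n → ι) (Y : Fin m → ι) :
    (List.ofFn fun j => a (Y j)).prod * (List.ofFn fun i => adag (X i)).reverse.prod =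
      ∑ C ∈ Finset.range (n + 1), wickSum a adag C X Y := by
  induction n generalizing m with
  | zero => simp [wickSum_zero]
  | succ n ih =>
    rw [List.ofFn_succ', List.concat_eq_append, List.reverse_append, List.reverse_singleton,
      List.singleton_append, List.prod_cons, ← mul_assoc, prod_ofFn_mul_adag a adag hcar1,
      add_mul, smul_mul_assoc, mul_assoc, ih]
    have hshift : (∑ C ∈ Finset.range (n + 1), wickSum a adag C (fun k => X k.castSucc) Y) =
        ∑ C ∈ Finset.range (n + 1), wickSum a adag (C + 1) (fun k => X k.castSucc) Y +
          wickSum a adag 0 (fun k => X k.castSucc) Y := by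
      rw [← Finset.sum_range_succ' (fun C => wickSum a adag C (fun k => X k.castSucc) Y),
        Finset.sum_range_succ _ (n + 1), wickSum_zero_left _ _ _ _ (Nat.lt_succ_self n), add_zero]
    rw [hshift, Finset.sum_range_succ' _ (n + 1), wickSum_zero_succ, mul_add, smul_add,
      add_right_comm]
    congr 1
    cases m with
    | zero => simp [wickSum_zero_right]
    | succ m =>
      simp only [wickSum_succ, Finset.sum_add_distrib, Finset.mul_sum, Finset.smul_sum]
      rw [add_comm]
      congr 1
      rw [Finset.sum_comm, Finset.sum_mul]
      refine Finset.sum_congr rfl fun j _ => ?_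
      rw [← Finset.smul_sum, ← ih, smul_mul_assoc,
        List.prod_ofFn_succAbove (fun k => if k = j then 1 else a (Y k)) j (if_pos rfl)]
      simp only [Fin.succAbove_ne, if_false]
      congr 2
      rw [show (m + 1 + j + 1 : ℕ) = m + j + 2 by ring, pow_add]
      simp

theorem FOp_mul_FOp (a adag : ι → R)
    (hcar1 : ∀ i j, a i * adag j + adag j * a i = if i = j then 1 else 0)
    {nA mA nB mB : ℕ} (fA : ((Fin nA → ι) × (Fin mA → ι)) →₀ ℂ)
    (fB : ((Fin nB → ι) × (Fin mB → ι)) →₀ ℂ) :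
    FOp a adag fA * FOp a adag fB =
      (fA.sum fun XYA cA => fB.sum fun XYB cB => ((-1) ^ (mA * nB) * cA * cB : ℂ) •
        ((List.ofFn fun i => adag (XYA.1 i)).reverse.prod *
          (List.ofFn fun i => adag (XYB.1 i)).reverse.prod *
          (List.ofFn fun j => a (XYA.2 j)).prod * (List.ofFn fun j => a (XYB.2 j)).prod)) +
      FAttachF a adag fA fB := by
  have hattach : FAttachF a adag fA fB =
      fA.sum fun XYA cA => fB.sum fun XYB cB => (cA * cB) •
        ((List.ofFn fun i => adag (XYA.1 i)).reverse.prod *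
          (∑ C ∈ Finset.Icc 1 (min mA nB), wickSum a adag C XYB.1 XYA.2) *
          (List.ofFn fun j => a (XYB.2 j)).prod) := by
    simp only [FAttachF, Finsupp.sum, wickSum, Finset.mul_sum, Finset.sum_mul, Finset.smul_sum]
    simp only [Finset.sum_comm (s := fB.support)]
    simp only [Finset.sum_comm (s := fA.support)]
    refine Finset.sum_congr rfl fun C _ => Finset.sum_congr rfl fun π _ =>
      Finset.sum_congr rfl fun π' _ => Finset.sum_congr rfl fun XYB _ =>
      Finset.sum_congr rfl fun XYA _ => ?_
    rw [mul_smul_comm, smul_mul_assoc, smul_smul]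
    congr 1
    · rw [contractionWeight]
      ring
    · simp only [remCre, remAnn, mul_assoc]
  have hsum : ∀ (X : Fin nB → ι) (Y : Fin mA → ι),
      ∑ C ∈ Finset.range (nB + 1), wickSum a adag C X Y =
        wickSum a adag 0 X Y + ∑ C ∈ Finset.Icc 1 (min mA nB), wickSum a adag C X Y := by
    intro X Y
    rw [Finset.range_eq_Ico, Finset.sum_eq_sum_Ico_succ_bot (Nat.succ_pos nB)]
    congr 1
    symm
    refine Finset.sum_subset (fun C hC => ?_) fun C hC hC' => wickSum_zero_right _ _ _ _ ?_
    · simp only [Finset.mem_Icc, Finset.mem_Ico] at *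
      omega
    · simp only [Finset.mem_Icc, Finset.mem_Ico] at *
      omega
  rw [hattach]
  simp only [FOp, Finsupp.sum, Finset.sum_mul_sum, ← Finset.sum_add_distrib]
  refine Finset.sum_congr rfl fun XYA _ => Finset.sum_congr rfl fun XYB _ => ?_
  rw [smul_mul_smul_comm, mul_assoc, ← mul_assoc (List.ofFn fun j => a (XYA.2 j)).prod,
    wick_theorem a adag hcar1, hsum, wickSum_zero, add_mul, mul_add, smul_add, smul_mul_assoc,
    mul_smul_comm, smul_smul]
  congr 2
  · ring
  · simp only [mul_assoc]
  · simp only [mul_assoc]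

theorem List.prod_mul_prod_anticomm {S : Type*} [Ring S] (l₁ l₂ : List S)
    (h : ∀ x ∈ l₁, ∀ y ∈ l₂, x * y + y * x = 0) :
    l₁.prod * l₂.prod = (-1) ^ (l₁.length * l₂.length) * (l₂.prod * l₁.prod) := by
  have hcomm : ∀ (n : ℕ) (x : S), x * (-1) ^ n = (-1) ^ n * x := fun n x =>
    ((Commute.neg_one_right x).pow_right n)
  have hone : ∀ (x : S) (l : List S), (∀ y ∈ l, x * y + y * x = 0) →
      x * l.prod = (-1) ^ l.length * (l.prod * x) := by
    intro x l hl
    induction l with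
    | nil => simp
    | cons y l ih =>
      rw [List.prod_cons, ← mul_assoc, eq_neg_of_add_eq_zero_left (hl y (by simp)), neg_mul,
        mul_assoc, ih fun z hz => hl z (by simp [hz]), ← mul_assoc, hcomm, List.length_cons,
        pow_succ']
      simp only [mul_assoc, neg_mul, one_mul]
  induction l₁ with
  | nil => simp
  | cons x l₁ ih =>
    rw [List.prod_cons, mul_assoc, ih fun z hz => h z (by simp [hz]), ← mul_assoc, hcomm,
      mul_assoc, ← mul_assoc x, hone x l₂ (h x (by simp)), List.length_cons, Nat.succ_mul, pow_add]
    simp only [mul_assoc]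

/-- **Fermionic commutator formula** (Theorem 3.2, even case, discrete-mode form):
if `a, a⁺` satisfy the CAR and `(n_A + m_A)(n_B + m_B)` is even, then
`[Op(f_A), Op(f_B)] = Op(f_A) Γ₋ Op(f_B) − Op(f_B) Γ₋ Op(f_A)`. -/
theorem fermionic_commutator_formula (a adag : ι → R)
    (hcar1 : ∀ i j, a i * adag j + adag j * a i = if i = j then 1 else 0)
    (hcar2 : ∀ i j, a i * a j + a j * a i = 0)
    (hcar3 : ∀ i j, adag i * adag j + adag j * adag i = 0)
    {nA mA nB mB : ℕ} (hpar : Even ((nA + mA) * (nB + mB)))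
    (fA : ((Fin nA → ι) × (Fin mA → ι)) →₀ ℂ)
    (fB : ((Fin nB → ι) × (Fin mB → ι)) →₀ ℂ) :
    FOp a adag fA * FOp a adag fB - FOp a adag fB * FOp a adag fA =
      FAttachF a adag fA fB - FAttachF a adag fB fA := by
  have hsign : ∀ (k : ℕ) (x : R), (-1 : R) ^ k * x = (-1 : ℂ) ^ k • x := fun k x => by
    rcases Nat.even_or_odd k with hk | hk <;> simp [hk.neg_one_pow]
  rw [FOp_mul_FOp a adag hcar1, FOp_mul_FOp a adag hcar1, add_sub_add_comm, add_eq_right,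
    sub_eq_zero]
  simp only [Finsupp.sum]
  rw [Finset.sum_comm]
  refine Finset.sum_congr rfl fun XYB _ => Finset.sum_congr rfl fun XYA _ => ?_
  have hcre := List.prod_mul_prod_anticomm (List.ofFn fun i => adag (XYA.1 i)).reverse
    (List.ofFn fun i => adag (XYB.1 i)).reverse (by simp [hcar3])
  have hann := List.prod_mul_prod_anticomm (List.ofFn fun j => a (XYA.2 j))
    (List.ofFn fun j => a (XYB.2 j)) (by simp [hcar2])
  rw [List.length_reverse, List.length_reverse, List.length_ofFn, List.length_ofFn, hsign] at hcre
  rw [List.length_ofFn, List.length_ofFn, hsign] at hann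
  rw [mul_assoc _ (List.ofFn fun j => a (XYA.2 j)).prod, hcre, hann, smul_mul_smul_comm, smul_smul]
  congr 1
  swap
  · simp only [mul_assoc]
  have hpow : (-1 : ℂ) ^ (mA * nB + (nA * nB + mA * mB)) = (-1) ^ (mB * nA) := by
    apply neg_one_pow_congr
    simp only [Nat.even_add, Nat.even_mul] at hpar ⊢
    tauto
  rw [← hpow, pow_add, pow_add]
  ring
end
end

section
/- Normalized contraction identity (final display of the coherent-state proof of Lemma 3.3): for all C, n, m ∈ ℕ and all maps I : Fin n → Fin N and J : Fin m → Fin N, one has D^C (P_{I,J}) = C! · Σ_{(π, π')} (∏_{p ∈ Fin C} [I(π(p)) = J(π'(p))]) · (∏_{i not in the range of π} X_{I(i)}) · (∏_{j not in the range of π'} Y_{J(j)}), where the sum runs over all pairs (π, π') with π : Fin C → Fin n strictly decreasing and π' : Fin C → Fin m injective, and [P] denotes 1 if P holds and 0 otherwise. -/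
open scoped Classical

noncomputable section

open MvPolynomial

/-- The operator `D = Σ_k ∂_{X_k} ∘ ∂_{Y_k}` on polynomials in the variables
`X_k` (left copy) and `Y_k` (right copy), `k ∈ Fin N`. -/
def Dop (N : ℕ) : Module.End ℂ (MvPolynomial (Fin N ⊕ Fin N) ℂ) :=
  ∑ k : Fin N, (pderiv (Sum.inl k)).toLinearMap ∘ₗ (pderiv (Sum.inr k)).toLinearMap

theorem MvPolynomial.pderiv_prod_X {R σ ι : Type*} [CommSemiring R] [DecidableEq σ] [DecidableEq ι]
    (k : σ) (v : ι → σ) (s : Finset ι) :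
    pderiv k (∏ i ∈ s, (X (v i) : MvPolynomial σ R)) =
      ∑ i ∈ s, if v i = k then ∏ j ∈ s.erase i, X (v j) else 0 := by
  induction s using Finset.induction_on with
  | empty => simp
  | insert a s ha ih =>
    rw [Finset.prod_insert ha, Derivation.leibniz, ih, Finset.sum_insert ha,
      Finset.erase_insert ha, pderiv_X, add_comm, smul_eq_mul, smul_eq_mul, Finset.mul_sum]
    congr 1
    · by_cases h : v a = k
      · subst h; simp
      · simp [h]
    · refine Finset.sum_congr rfl fun i hi => ?_
      have hai : a ≠ i := fun h => ha (h ▸ hi)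
      split_ifs
      · rw [Finset.erase_insert_of_ne hai, Finset.prod_insert (by simp [ha])]
      · simp

/-- The monomial `Π_{i ∈ s} X_{I i} · Π_{j ∈ t} Y_{J j}`. -/
def pairMonomial {N : ℕ} {ι κ : Type*} (I : ι → Fin N) (J : κ → Fin N) (s : Finset ι)
    (t : Finset κ) : MvPolynomial (Fin N ⊕ Fin N) ℂ :=
  (∏ i ∈ s, X (Sum.inl (I i))) * ∏ j ∈ t, X (Sum.inr (J j))

theorem Dop_pairMonomial {N : ℕ} {ι κ : Type*} [DecidableEq ι] [DecidableEq κ]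
    (I : ι → Fin N) (J : κ → Fin N) (s : Finset ι) (t : Finset κ) :
    Dop N (pairMonomial I J s t) =
      ∑ i ∈ s, ∑ j ∈ t, (if I i = J j then (1 : ℂ) else 0) •
        pairMonomial I J (s.erase i) (t.erase j) := by
  have hX (k : Fin N) : pderiv (Sum.inr k)
      (∏ i ∈ s, (X (Sum.inl (I i)) : MvPolynomial (Fin N ⊕ Fin N) ℂ)) = 0 := by
    rw [pderiv_prod_X (Sum.inr k) fun i => Sum.inl (I i)]; simp
  have hY (k : Fin N) (t' : Finset κ) : pderiv (Sum.inl k)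
      (∏ j ∈ t', (X (Sum.inr (J j)) : MvPolynomial (Fin N ⊕ Fin N) ℂ)) = 0 := by
    rw [pderiv_prod_X (Sum.inl k) fun j => Sum.inr (J j)]; simp
  have hk (k : Fin N) : pderiv (Sum.inl k) (pderiv (Sum.inr k) (pairMonomial I J s t)) =
      ∑ i ∈ s, ∑ j ∈ t, if I i = k then (if J j = k then
        pairMonomial I J (s.erase i) (t.erase j) else 0) else 0 := by
    have hY' (j : κ) : pderiv (Sum.inl k) (if J j = k then
        ∏ j' ∈ t.erase j, (X (Sum.inr (J j')) : MvPolynomial (Fin N ⊕ Fin N) ℂ) else 0) = 0 := by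
      split_ifs
      · exact hY k _
      · simp
    rw [pairMonomial, Derivation.leibniz, hX, smul_zero, add_zero,
      pderiv_prod_X (Sum.inr k) fun j => Sum.inr (J j)]
    simp only [Sum.inr.injEq]
    rw [smul_eq_mul, Derivation.leibniz, map_sum]
    simp only [hY', Finset.sum_const_zero, smul_zero, zero_add]
    rw [pderiv_prod_X (Sum.inl k) fun i => Sum.inl (I i), smul_eq_mul, mul_comm,
      Finset.sum_mul_sum]
    refine Finset.sum_congr rfl fun i _ => Finset.sum_congr rfl fun j _ => ?_
    simp only [Sum.inl.injEq, pairMonomial]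
    split_ifs <;> simp
  simp only [Dop, LinearMap.sum_apply, LinearMap.comp_apply, Derivation.coeFn_coe, hk]
  rw [Finset.sum_comm]
  refine Finset.sum_congr rfl fun i _ => ?_
  rw [Finset.sum_comm]
  refine Finset.sum_congr rfl fun j _ => ?_
  simp [eq_comm]

theorem Fin.sum_injective_succ {α M : Type*} [Fintype α] [DecidableEq α] [AddCommMonoid M]
    {C : ℕ} (f : (Fin (C + 1) → α) → M) :
    ∑ π ∈ Finset.univ.filter (fun π : Fin (C + 1) → α => Function.Injective π), f π =
      ∑ π ∈ Finset.univ.filter (fun π : Fin C → α => Function.Injective π),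
        ∑ a ∈ Finset.univ.filter (fun a => a ∉ Set.range π), f (Fin.cons a π) := by
  simp only [Finset.sum_filter]
  rw [← (Fin.consEquiv fun _ => α).sum_comp, Fintype.sum_prod_type, Finset.sum_comm]
  refine Finset.sum_congr rfl fun π _ => ?_
  simp only [Fin.consEquiv, Equiv.coe_fn_mk, Fin.cons_injective_iff]
  by_cases h : Function.Injective π <;> simp [h]

theorem Fin.filter_notMem_range_cons {α : Type*} [Fintype α] [DecidableEq α] {C : ℕ} (a : α)
    (π : Fin C → α) :
    Finset.univ.filter (fun x => x ∉ Set.range (Fin.cons a π : Fin (C + 1) → α)) =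
      (Finset.univ.filter fun x => x ∉ Set.range π).erase a := by
  ext x
  simp [Fin.range_cons]

/-- The coefficient `Π_c [I (π c) = J (π' c)]` times the monomial of the variables outside the
ranges of `π` and `π'`. -/
def contractionTerm {N C : ℕ} {ι κ : Type*} [Fintype ι] [DecidableEq ι]
    [Fintype κ] [DecidableEq κ] (I : ι → Fin N) (J : κ → Fin N)
    (π : Fin C → ι) (π' : Fin C → κ) : MvPolynomial (Fin N ⊕ Fin N) ℂ :=
  (∏ c, if I (π c) = J (π' c) then (1 : ℂ) else 0) •
    pairMonomial I J (Finset.univ.filter fun i => i ∉ Set.range π)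
      (Finset.univ.filter fun j => j ∉ Set.range π')

theorem contractionTerm_comp_perm {N C : ℕ} {ι κ : Type*} [Fintype ι] [DecidableEq ι]
    [Fintype κ] [DecidableEq κ]
    (I : ι → Fin N) (J : κ → Fin N) (π : Fin C → ι) (π' : Fin C → κ) (σ : Equiv.Perm (Fin C)) :
    contractionTerm I J (π ∘ σ) (π' ∘ σ) = contractionTerm I J π π' := by
  simp only [contractionTerm, σ.surjective.range_comp, Function.comp_apply]
  rw [Equiv.prod_comp σ fun c => if I (π c) = J (π' c) then (1 : ℂ) else 0]

theorem Dop_contractionTerm {N C : ℕ} {ι κ : Type*} [Fintype ι] [DecidableEq ι]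
    [Fintype κ] [DecidableEq κ]
    (I : ι → Fin N) (J : κ → Fin N) (π : Fin C → ι) (π' : Fin C → κ) :
    Dop N (contractionTerm I J π π') =
      ∑ i ∈ Finset.univ.filter (fun i => i ∉ Set.range π),
        ∑ j ∈ Finset.univ.filter (fun j => j ∉ Set.range π'),
          contractionTerm I J (Fin.cons i π : Fin (C + 1) → ι) (Fin.cons j π') := by
  simp only [contractionTerm, Fin.filter_notMem_range_cons, map_smul, Dop_pairMonomial,
    Finset.smul_sum, smul_smul, Fin.prod_univ_succ, Fin.cons_zero, Fin.cons_succ]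
  refine Finset.sum_congr rfl fun i _ => Finset.sum_congr rfl fun j _ => ?_
  rw [mul_comm]

theorem Dop_pow_pairMonomial {N : ℕ} (C : ℕ) {ι κ : Type*} [Fintype ι] [DecidableEq ι] [Fintype κ]
    [DecidableEq κ] (I : ι → Fin N) (J : κ → Fin N) :
    (Dop N ^ C) (pairMonomial I J Finset.univ Finset.univ) =
      ∑ π ∈ Finset.univ.filter (fun π : Fin C → ι => Function.Injective π),
        ∑ π' ∈ Finset.univ.filter (fun π' : Fin C → κ => Function.Injective π'),
          contractionTerm I J π π' := by
  induction C with
  | zero => simp [contractionTerm, Function.injective_of_subsingleton]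
  | succ C ih =>
    rw [pow_succ', Module.End.mul_apply, ih]
    simp only [map_sum, Dop_contractionTerm, Fin.sum_injective_succ]
    exact Finset.sum_congr rfl fun π _ => Finset.sum_comm

theorem Fin.sum_injective_eq_sum_strictAnti {α M : Type*} [LinearOrder α] [Fintype α]
    [AddCommMonoid M] {C : ℕ} (f : (Fin C → α) → M) :
    ∑ π ∈ Finset.univ.filter (fun π : Fin C → α => Function.Injective π), f π =
      ∑ π ∈ Finset.univ.filter (fun π : Fin C → α => StrictAnti π),
        ∑ σ : Equiv.Perm (Fin C), f (π ∘ σ) := by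
  rw [← Finset.sum_product']
  symm
  refine Finset.sum_bij (fun p _ => p.1 ∘ p.2) ?_ ?_ ?_ fun _ _ => rfl
  · rintro ⟨π, σ⟩ h
    simp only [Finset.mem_product, Finset.mem_filter, Finset.mem_univ, true_and,
      and_true] at h ⊢
    exact h.injective.comp σ.injective
  · rintro ⟨π, σ⟩ h ⟨ρ, τ⟩ h' heq
    simp only [Finset.mem_product, Finset.mem_filter, Finset.mem_univ, true_and,
      and_true] at h h' heq
    have hr : Set.range π = Set.range ρ := by
      rw [← σ.surjective.range_comp π, heq, τ.surjective.range_comp ρ]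
    have hrd : Set.range (OrderDual.toDual ∘ π) = Set.range (OrderDual.toDual ∘ ρ) := by
      rw [Set.range_comp, Set.range_comp, hr]
    have hπ : π = ρ := (StrictMono.range_inj h.dual_right h'.dual_right).1 hrd
    subst hπ
    rw [Prod.mk.injEq]
    exact ⟨rfl, Equiv.ext fun c => h.injective (congrFun heq c)⟩
  · intro π h
    simp only [Finset.mem_filter, Finset.mem_univ, true_and] at h
    let σ := Tuple.sort (OrderDual.toDual ∘ π)
    have hanti : Antitone (π ∘ σ) := fun a b hab =>
      Tuple.monotone_sort (OrderDual.toDual ∘ π) hab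
    refine ⟨(π ∘ σ, σ⁻¹), ?_, ?_⟩
    · simpa using hanti.strictAnti_of_injective (h.comp σ.injective)
    · funext c
      simp

theorem Finset.sum_injective_comp_perm {γ α M : Type*} [Fintype γ] [DecidableEq γ] [Fintype α]
    [DecidableEq α] [AddCommMonoid M] (σ : Equiv.Perm γ) (f : (γ → α) → M) :
    ∑ π ∈ Finset.univ.filter (fun π : γ → α => Function.Injective π), f (π ∘ σ) =
      ∑ π ∈ Finset.univ.filter (fun π : γ → α => Function.Injective π), f π := by
  refine Finset.sum_equiv (σ.symm.arrowCongr (Equiv.refl α)) (fun π => ?_) fun π _ => rfl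
  simp only [Finset.mem_filter, Finset.mem_univ, true_and]
  exact (σ.injective_comp π).symm

/-- **Normalized contraction identity** (final display of the coherent-state proof of
Lemma 3.3): `D^C (Π_i X_{I i} · Π_j Y_{J j})` equals `C!` times the sum over all pairs
`(π, π')` with `π : Fin C → Fin n` strictly decreasing and `π' : Fin C → Fin m`
injective of `(Π_p [I (π p) = J (π' p)]) · Π_{i ∉ range π} X_{I i} · Π_{j ∉ range π'} Y_{J j}`. -/
theorem iterated_derivative_contraction_identity_normalized (N C n m : ℕ)
    (I : Fin n → Fin N) (J : Fin m → Fin N) :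
    (Dop N ^ C)
        ((∏ i : Fin n, (X (Sum.inl (I i)) : MvPolynomial (Fin N ⊕ Fin N) ℂ)) *
          ∏ j : Fin m, X (Sum.inr (J j))) =
      C.factorial •
        ∑ p ∈ Finset.univ.filter
            (fun p : (Fin C → Fin n) × (Fin C → Fin m) =>
              StrictAnti p.1 ∧ Function.Injective p.2),
          (∏ c : Fin C, if I (p.1 c) = J (p.2 c) then (1 : ℂ) else 0) •
            ((∏ i ∈ Finset.univ.filter (fun i => i ∉ Set.range p.1),
                (X (Sum.inl (I i)) : MvPolynomial (Fin N ⊕ Fin N) ℂ)) *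
              ∏ j ∈ Finset.univ.filter (fun j => j ∉ Set.range p.2),
                X (Sum.inr (J j))) := by
  have hD := Dop_pow_pairMonomial C I J
  rw [Fin.sum_injective_eq_sum_strictAnti] at hD
  rw [pairMonomial] at hD
  rw [hD, ← Finset.univ_product_univ, Finset.filter_product, Finset.sum_product,
    Finset.smul_sum]
  refine Finset.sum_congr rfl fun π _ => ?_
  have hσ (σ : Equiv.Perm (Fin C)) :
      ∑ π' ∈ Finset.univ.filter (fun π' : Fin C → Fin m => Function.Injective π'),
          contractionTerm I J (π ∘ σ) π' =
        ∑ π' ∈ Finset.univ.filter (fun π' : Fin C → Fin m => Function.Injective π'),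
          contractionTerm I J π π' := by
    rw [← Finset.sum_injective_comp_perm σ]
    simp only [contractionTerm_comp_perm]
  simp only [hσ, Finset.sum_const, Finset.card_univ, Fintype.card_perm, Fintype.card_fin]
  simp only [contractionTerm, pairMonomial]
end
end
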